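/- Norm of the second-order embedding via the first eigenvalue: let 1 < p, q < ∞ and I = [0, t₀]. Then sup over nonzero u in W^{2,p}_D(I) of ‖u‖_{L^q(I)} / ‖u''‖_{L^p(I)} equals t₀^{1/q - 1/p + 2}·λ₁^{-1/q}, where λ₁ is the smallest λ > 0 for which the Navier problem (⌊u''⌉^{p-1})'' = λ⌊u⌉^{q-1} on [0,1] with ‖u''‖_{L^p(0,1)} = 1 has a solution positive on (0,1). -/

import Mathlib

/-- Signed power ⌊x⌉^r = |x|^r · sgn x. -/
noncomputable def spow (r x : ℝ) : ℝ := |x| ^ r * Real.sign x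

/-- u solves (⌊u''⌉^{p-1})'' = λ⌊u⌉^{q-1} on [0,t₀] with Navier boundary conditions. -/
def NavierSol (p q lam t₀ : ℝ) (u : ℝ → ℝ) : Prop :=
  ContDiff ℝ 2 u ∧ ContDiff ℝ 2 (fun t => spow (p - 1) (deriv (deriv u) t)) ∧
  (∀ t ∈ Set.Icc (0:ℝ) t₀,
    deriv (deriv fun s => spow (p - 1) (deriv (deriv u) s)) t = lam * spow (q - 1) (u t)) ∧
  u 0 = 0 ∧ u t₀ = 0 ∧ deriv (deriv u) 0 = 0 ∧ deriv (deriv u) t₀ = 0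

open MeasureTheory Set Filter Topology

lemma spow_zero (r : ℝ) : spow r 0 = 0 := by simp [spow]

lemma spow_neg (r x : ℝ) : spow r (-x) = -spow r x := by
  simp only [spow, abs_neg]
  rcases lt_trichotomy x 0 with h | h | h
  · rw [Real.sign_of_neg h, Real.sign_of_pos (by linarith)]; ring
  · simp [h]
  · rw [Real.sign_of_pos h, Real.sign_of_neg (by linarith)]; ring

lemma spow_of_nonneg {r x : ℝ} (hr : 0 < r) (hx : 0 ≤ x) : spow r x = x ^ r := by
  rcases hx.eq_or_lt with rfl | h
  · simp [spow, Real.zero_rpow hr.ne']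
  · simp [spow, Real.sign_of_pos h, abs_of_pos h]

lemma spow_eq_sub {r : ℝ} (hr : 0 < r) (x : ℝ) :
    spow r x = (max x 0) ^ r - (max (-x) 0) ^ r := by
  rcases le_total 0 x with h | h
  · rw [spow_of_nonneg hr h, max_eq_left h, max_eq_right (by linarith), Real.zero_rpow hr.ne',
      sub_zero]
  · rw [← neg_neg x, spow_neg, spow_of_nonneg hr (by linarith), max_eq_right (by linarith),
      neg_neg, max_eq_left (by linarith), Real.zero_rpow hr.ne', zero_sub]

lemma continuous_spow {r : ℝ} (hr : 0 < r) : Continuous (spow r) := by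
  rw [funext (spow_eq_sub hr)]
  exact ((continuous_id.max continuous_const).rpow_const fun _ => .inr hr.le).sub
    ((continuous_neg.max continuous_const).rpow_const fun _ => .inr hr.le)

lemma spow_mul_spow {r s c : ℝ} (hr : 0 < r) (hs : 0 < s) (hrs : s * r = 1) (hc : 0 ≤ c) (x : ℝ) :
    spow r (c * spow s x) = c ^ r * x := by
  have key : ∀ y : ℝ, 0 ≤ y → spow r (c * spow s y) = c ^ r * y := fun y hy => by
    rw [spow_of_nonneg hs hy, spow_of_nonneg hr (mul_nonneg hc (Real.rpow_nonneg hy s)),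
      Real.mul_rpow hc (Real.rpow_nonneg hy s), ← Real.rpow_mul hy, hrs, Real.rpow_one]
  rcases le_total 0 x with h | h
  · exact key x h
  · have := key (-x) (by linarith)
    rw [spow_neg, mul_neg, spow_neg] at this
    linarith

lemma mul_spow_sub_one {p : ℝ} (hp : 1 < p) (x : ℝ) : x * spow (p - 1) x = |x| ^ p := by
  have key : ∀ y : ℝ, 0 ≤ y → y * spow (p - 1) y = |y| ^ p := fun y hy => by
    rw [spow_of_nonneg (by linarith) hy, abs_of_nonneg hy]
    nth_rw 1 [← Real.rpow_one y]
    rw [← Real.rpow_add' hy (by linarith), add_sub_cancel]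
  rcases le_total 0 x with h | h
  · exact key x h
  · have := key (-x) (by linarith)
    rw [spow_neg, abs_neg] at this
    linarith

/-- Weighted Young inequality; see `eq_of_mul_rpow_sub_one_eq` for the equality case. -/
lemma mul_rpow_sub_one_le {q x y : ℝ} (hq : 1 < q) (hx : 0 ≤ x) (hy : 0 ≤ y) :
    q * (x * y ^ (q - 1)) ≤ x ^ q + (q - 1) * y ^ q := by
  rcases hy.eq_or_lt with rfl | hy
  · rw [Real.zero_rpow (by linarith), Real.zero_rpow (by linarith)]
    simpa using Real.rpow_nonneg hx q
  have h := one_add_mul_self_le_rpow_one_add (s := x / y - 1)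
    (by linarith [div_nonneg hx hy.le]) hq.le
  rw [add_sub_cancel, Real.div_rpow hx hy.le, le_div_iff₀ (Real.rpow_pos_of_pos hy q)] at h
  have e : y ^ q = y * y ^ (q - 1) := by
    rw [Real.rpow_sub_one hy.ne']; field_simp
  have e2 : (1 + q * (x / y - 1)) * y ^ q = q * (x * y ^ (q - 1)) - (q - 1) * y ^ q := by
    rw [e]; field_simp; ring
  linarith

lemma eq_of_mul_rpow_sub_one_eq {q x y : ℝ} (hq : 1 < q) (hx : 0 ≤ x) (hy : 0 ≤ y)
    (h : q * (x * y ^ (q - 1)) = x ^ q + (q - 1) * y ^ q) : x = y := by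
  rcases hy.eq_or_lt with rfl | hy
  · rw [Real.zero_rpow (by linarith), Real.zero_rpow (by linarith)] at h
    simp only [mul_zero, add_zero] at h
    exact ((Real.rpow_eq_zero hx (by linarith)).1 h.symm)
  by_contra hne
  have hs : x / y - 1 ≠ 0 := fun h0 => hne (by field_simp at h0; linarith)
  have h' := one_add_mul_self_lt_rpow_one_add (s := x / y - 1)
    (by linarith [div_nonneg hx hy.le]) hs hq
  rw [add_sub_cancel, Real.div_rpow hx hy.le, lt_div_iff₀ (Real.rpow_pos_of_pos hy q)] at h'
  have e : y ^ q = y * y ^ (q - 1) := by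
    rw [Real.rpow_sub_one hy.ne']; field_simp
  have e2 : (1 + q * (x / y - 1)) * y ^ q = q * (x * y ^ (q - 1)) - (q - 1) * y ^ q := by
    rw [e]; field_simp; ring
  linarith

lemma integral_mul_second_deriv {u u' u'' w w' w'' : ℝ → ℝ}
    (hu : ∀ t, HasDerivAt u (u' t) t) (hu' : ∀ t, HasDerivAt u' (u'' t) t) (hu'' : Continuous u'')
    (hw : ∀ t, HasDerivAt w (w' t) t) (hw' : ∀ t, HasDerivAt w' (w'' t) t) (hw'' : Continuous w'')
    (u0 : u 0 = 0) (u1 : u 1 = 0) (w0 : w 0 = 0) (w1 : w 1 = 0) :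
    ∫ t in (0:ℝ)..1, u t * w'' t = ∫ t in (0:ℝ)..1, u'' t * w t := by
  have cu : Continuous u := continuous_iff_continuousAt.2 fun t => (hu t).continuousAt
  have cw : Continuous w := continuous_iff_continuousAt.2 fun t => (hw t).continuousAt
  have h := intervalIntegral.integral_eq_sub_of_hasDerivAt (a := 0) (b := 1)
    (f := fun t => u t * w' t - u' t * w t) (f' := fun t => u t * w'' t - u'' t * w t)
    (fun t _ => (((hu t).mul (hw' t)).sub ((hu' t).mul (hw t))).congr_deriv (by ring))
    (((cu.mul hw'').sub (hu''.mul cw)).intervalIntegrable _ _)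
  rw [intervalIntegral.integral_sub (Continuous.intervalIntegrable (by fun_prop) _ _)
    (Continuous.intervalIntegrable (by fun_prop) _ _)] at h
  simp only [u0, u1, w0, w1, zero_mul, mul_zero, sub_self] at h
  linarith

lemma contDiff_two_of_hasDerivAt {u u' u'' : ℝ → ℝ}
    (hu : ∀ t, HasDerivAt u (u' t) t) (hu' : ∀ t, HasDerivAt u' (u'' t) t)
    (hu'' : Continuous u'') : ContDiff ℝ 2 u := by
  have e1 : deriv u = u' := funext fun t => (hu t).deriv
  have e2 : deriv u' = u'' := funext fun t => (hu' t).deriv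
  have h1 : ContDiff ℝ 1 u' :=
    contDiff_one_iff_deriv.2 ⟨fun t => (hu' t).differentiableAt, e2 ▸ hu''⟩
  have : ContDiff ℝ (1 + 1) u := contDiff_succ_iff_deriv.2
    ⟨fun t => (hu t).differentiableAt, by simp, e1 ▸ h1⟩
  simpa [one_add_one_eq_two] using this

lemma ContDiff.hasDerivAt_two {u : ℝ → ℝ} (hu : ContDiff ℝ 2 u) :
    (∀ t, HasDerivAt u (deriv u t) t) ∧ (∀ t, HasDerivAt (deriv u) (deriv (deriv u) t) t) ∧
      Continuous (deriv (deriv u)) := by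
  have h : ContDiff ℝ (1 + 1) u := by simpa [one_add_one_eq_two] using hu
  obtain ⟨h1, -, h2⟩ := contDiff_succ_iff_deriv.1 h
  obtain ⟨h3, h4⟩ := contDiff_one_iff_deriv.1 h2
  exact ⟨fun t => (h1 t).hasDerivAt, fun t => (h3 t).hasDerivAt, h4⟩

/-- The solution operator of `-u'' = f`, `u 0 = u 1 = 0`. -/
noncomputable def green (f : ℝ → ℝ) (t : ℝ) : ℝ :=
  (1 - t) * (∫ s in (0:ℝ)..t, s * f s) + t * ∫ s in t..1, (1 - s) * f s

/-- The derivative of `green f`. -/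
noncomputable def greenDeriv (f : ℝ → ℝ) (t : ℝ) : ℝ :=
  (∫ s in t..1, (1 - s) * f s) - ∫ s in (0:ℝ)..t, s * f s

lemma hasDerivAt_green_left {f : ℝ → ℝ} (hf : Continuous f) (t : ℝ) :
    HasDerivAt (fun t => ∫ s in (0:ℝ)..t, s * f s) (t * f t) t :=
  intervalIntegral.integral_hasDerivAt_right ((continuous_id.mul hf).intervalIntegrable _ _)
    (continuous_id.mul hf).aestronglyMeasurable.stronglyMeasurableAtFilter
    (continuous_id.mul hf).continuousAt

lemma hasDerivAt_green_right {f : ℝ → ℝ} (hf : Continuous f) (t : ℝ) :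
    HasDerivAt (fun t => ∫ s in t..1, (1 - s) * f s) (-((1 - t) * f t)) t := by
  have c : Continuous fun s => (1 - s) * f s := by fun_prop
  exact intervalIntegral.integral_hasDerivAt_left (c.intervalIntegrable _ _)
    c.aestronglyMeasurable.stronglyMeasurableAtFilter c.continuousAt

lemma hasDerivAt_green {f : ℝ → ℝ} (hf : Continuous f) (t : ℝ) :
    HasDerivAt (green f) (greenDeriv f t) t :=
  ((((hasDerivAt_id t).const_sub 1).mul (hasDerivAt_green_left hf t)).add
    ((hasDerivAt_id t).mul (hasDerivAt_green_right hf t))).congr_deriv (by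
      simp only [greenDeriv, id]; ring)

lemma hasDerivAt_greenDeriv {f : ℝ → ℝ} (hf : Continuous f) (t : ℝ) :
    HasDerivAt (greenDeriv f) (-f t) t :=
  ((hasDerivAt_green_right hf t).sub (hasDerivAt_green_left hf t)).congr_deriv (by ring)

lemma continuous_green {f : ℝ → ℝ} (hf : Continuous f) : Continuous (green f) :=
  continuous_iff_continuousAt.2 fun t => (hasDerivAt_green hf t).continuousAt

lemma contDiff_green {f : ℝ → ℝ} (hf : Continuous f) : ContDiff ℝ 2 (green f) :=
  contDiff_two_of_hasDerivAt (hasDerivAt_green hf) (hasDerivAt_greenDeriv hf) hf.neg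

lemma deriv_deriv_green {f : ℝ → ℝ} (hf : Continuous f) (t : ℝ) :
    deriv (deriv (green f)) t = -f t := by
  rw [funext fun t => (hasDerivAt_green hf t).deriv]
  exact (hasDerivAt_greenDeriv hf t).deriv

lemma green_zero (f : ℝ → ℝ) : green f 0 = 0 := by simp [green]

lemma green_one (f : ℝ → ℝ) : green f 1 = 0 := by simp [green]

lemma integral_green_mul {f g : ℝ → ℝ} (hf : Continuous f) (hg : Continuous g) :
    ∫ t in (0:ℝ)..1, green f t * g t = ∫ t in (0:ℝ)..1, f t * green g t := by
  have h := integral_mul_second_deriv (hasDerivAt_green hf) (hasDerivAt_greenDeriv hf) hf.neg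
    (hasDerivAt_green hg) (hasDerivAt_greenDeriv hg) hg.neg (green_zero f) (green_one f)
    (green_zero g) (green_one g)
  simpa using h

lemma green_neg_deriv_deriv {u : ℝ → ℝ} (hu : ContDiff ℝ 2 u) (u0 : u 0 = 0) (u1 : u 1 = 0)
    (t : ℝ) : green (fun s => -deriv (deriv u) s) t = u t := by
  obtain ⟨h1, h2, h3⟩ := hu.hasDerivAt_two
  have hl := intervalIntegral.integral_eq_sub_of_hasDerivAt (a := 0) (b := t)
    (f := fun s => u s - s * deriv u s) (f' := fun s => s * -deriv (deriv u) s)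
    (fun s _ => ((h1 s).sub ((hasDerivAt_id s).mul (h2 s))).congr_deriv (by simp))
    (Continuous.intervalIntegrable (by fun_prop) _ _)
  have hr := intervalIntegral.integral_eq_sub_of_hasDerivAt (a := t) (b := 1)
    (f := fun s => -u s - (1 - s) * deriv u s) (f' := fun s => (1 - s) * -deriv (deriv u) s)
    (fun s _ => ((h1 s).neg.sub (((hasDerivAt_id s).const_sub 1).mul (h2 s))).congr_deriv
      (by simp))
    (Continuous.intervalIntegrable (by fun_prop) _ _)
  rw [green, hl, hr, u0, u1]
  ring

lemma green_const_mul (c : ℝ) (f : ℝ → ℝ) (t : ℝ) :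
    green (fun s => c * f s) t = c * green f t := by
  simp only [green, mul_left_comm _ c, intervalIntegral.integral_const_mul]
  ring

lemma green_mono {f g : ℝ → ℝ} (hf : Continuous f) (hg : Continuous g)
    (h : ∀ t ∈ Icc (0:ℝ) 1, f t ≤ g t) {t : ℝ} (ht : t ∈ Icc (0:ℝ) 1) :
    green f t ≤ green g t := by
  refine add_le_add (mul_le_mul_of_nonneg_left ?_ (by linarith [ht.2]))
    (mul_le_mul_of_nonneg_left ?_ ht.1)
  · refine intervalIntegral.integral_mono_on ht.1 (Continuous.intervalIntegrable (by fun_prop) _ _)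
      (Continuous.intervalIntegrable (by fun_prop) _ _) fun s hs => ?_
    exact mul_le_mul_of_nonneg_left (h s ⟨hs.1, hs.2.trans ht.2⟩) hs.1
  · refine intervalIntegral.integral_mono_on ht.2 (Continuous.intervalIntegrable (by fun_prop) _ _)
      (Continuous.intervalIntegrable (by fun_prop) _ _) fun s hs => ?_
    exact mul_le_mul_of_nonneg_left (h s ⟨ht.1.trans hs.1, hs.2⟩) (by linarith [hs.2])

lemma green_nonneg {f : ℝ → ℝ} (hf : Continuous f) (h : ∀ t ∈ Icc (0:ℝ) 1, 0 ≤ f t) {t : ℝ}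
    (ht : t ∈ Icc (0:ℝ) 1) : 0 ≤ green f t := by
  simpa [green] using green_mono continuous_const hf h ht

lemma abs_green_le {f : ℝ → ℝ} (hf : Continuous f) {t : ℝ} (ht : t ∈ Icc (0:ℝ) 1) :
    |green f t| ≤ green (fun s => |f s|) t := by
  refine abs_le.2 ⟨?_, green_mono hf hf.abs (fun s _ => le_abs_self _) ht⟩
  have h := green_mono (f := fun s => -f s) hf.neg hf.abs (fun s _ => neg_le_abs _) ht
  have e := green_const_mul (-1) f t
  simp only [neg_mul, one_mul] at e
  rw [e] at h
  linarith

lemma green_pos {f : ℝ → ℝ} (hf : Continuous f) (h : ∀ t ∈ Icc (0:ℝ) 1, 0 ≤ f t)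
    (hpos : ∃ c ∈ Ioo (0:ℝ) 1, 0 < f c) {t : ℝ} (ht : t ∈ Ioo (0:ℝ) 1) : 0 < green f t := by
  obtain ⟨c, hc, hfc⟩ := hpos
  have hk : Continuous fun s => s * (1 - s) * f s := by fun_prop
  have hI : 0 < ∫ s in (0:ℝ)..1, s * (1 - s) * f s := by
    refine intervalIntegral.integral_pos one_pos hk.continuousOn (fun s hs => ?_)
      ⟨c, Ioo_subset_Icc_self hc, ?_⟩
    · exact mul_nonneg (mul_nonneg hs.1.le (by linarith [hs.2])) (h s ⟨hs.1.le, hs.2⟩)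
    · exact mul_pos (mul_pos hc.1 (by linarith [hc.2])) hfc
  rw [← intervalIntegral.integral_add_adjacent_intervals (b := t) (hk.intervalIntegrable _ _)
    (hk.intervalIntegrable _ _)] at hI
  have hl : ∫ s in (0:ℝ)..t, s * (1 - s) * f s ≤ ∫ s in (0:ℝ)..t, s * f s := by
    refine intervalIntegral.integral_mono_on ht.1.le (hk.intervalIntegrable _ _)
      (Continuous.intervalIntegrable (by fun_prop) _ _) fun s hs => ?_
    have := h s ⟨hs.1, hs.2.trans ht.2.le⟩
    nlinarith [mul_nonneg (mul_nonneg hs.1 hs.1) this]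
  have hr : ∫ s in t..1, s * (1 - s) * f s ≤ ∫ s in t..1, (1 - s) * f s := by
    refine intervalIntegral.integral_mono_on ht.2.le (hk.intervalIntegrable _ _)
      (Continuous.intervalIntegrable (by fun_prop) _ _) fun s hs => ?_
    have := h s ⟨ht.1.le.trans hs.1, hs.2⟩
    have h1 : 0 ≤ 1 - s := by linarith [hs.2]
    nlinarith [mul_nonneg (mul_nonneg h1 h1) this]
  have hl0 : 0 ≤ ∫ s in (0:ℝ)..t, s * f s := intervalIntegral.integral_nonneg ht.1.le
    fun s hs => mul_nonneg hs.1 (h s ⟨hs.1, hs.2.trans ht.2.le⟩)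
  have hr0 : 0 ≤ ∫ s in t..1, (1 - s) * f s := intervalIntegral.integral_nonneg ht.2.le
    fun s hs => mul_nonneg (by linarith [hs.2]) (h s ⟨ht.1.le.trans hs.1, hs.2⟩)
  have h1t : 0 < 1 - t := by linarith [ht.2]
  rcases hl0.eq_or_lt with e | hl1
  · have : 0 < ∫ s in t..1, (1 - s) * f s := by linarith
    exact add_pos_of_nonneg_of_pos (mul_nonneg h1t.le hl0) (mul_pos ht.1 this)
  · exact add_pos_of_pos_of_nonneg (mul_pos h1t hl1) (mul_nonneg ht.1.le hr0)

lemma abs_greenDeriv_le {f : ℝ → ℝ} {p : ℝ} (hp : 1 < p) (hf : Continuous f)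
    (hf1 : ∫ s in (0:ℝ)..1, |f s| ^ p ≤ 1) {t : ℝ} (ht : t ∈ Icc (0:ℝ) 1) :
    |greenDeriv f t| ≤ 2 := by
  have hfp : Continuous fun s => |f s| ^ p := hf.abs.rpow_const fun _ => .inr (by linarith)
  have hi : ∫ s in (0:ℝ)..1, |f s| ≤ 2 := by
    calc ∫ s in (0:ℝ)..1, |f s| ≤ ∫ s in (0:ℝ)..1, (1 + |f s| ^ p) := by
          refine intervalIntegral.integral_mono_on zero_le_one (hf.abs.intervalIntegrable _ _)
            ((continuous_const.add hfp).intervalIntegrable _ _) fun s _ => ?_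
          rcases le_total |f s| 1 with h | h
          · linarith [Real.rpow_nonneg (abs_nonneg (f s)) p]
          · linarith [Real.self_le_rpow_of_one_le h hp.le]
      _ ≤ 2 := by
          rw [intervalIntegral.integral_add (continuous_const.intervalIntegrable _ _)
            (hfp.intervalIntegrable _ _)]
          simp only [intervalIntegral.integral_const, sub_zero, smul_eq_mul, mul_one]
          linarith
  rw [← intervalIntegral.integral_add_adjacent_intervals (b := t) (hf.abs.intervalIntegrable _ _)
    (hf.abs.intervalIntegrable _ _)] at hi
  have hl : |∫ s in (0:ℝ)..t, s * f s| ≤ ∫ s in (0:ℝ)..t, |f s| := by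
    refine (intervalIntegral.abs_integral_le_integral_abs ht.1).trans
      (intervalIntegral.integral_mono_on ht.1 (Continuous.intervalIntegrable (by fun_prop) _ _)
        (Continuous.intervalIntegrable (by fun_prop) _ _) fun s hs => ?_)
    rw [abs_mul, abs_of_nonneg hs.1]
    exact mul_le_of_le_one_left (abs_nonneg _) (hs.2.trans ht.2)
  have hr : |∫ s in t..1, (1 - s) * f s| ≤ ∫ s in t..1, |f s| := by
    refine (intervalIntegral.abs_integral_le_integral_abs ht.2).trans
      (intervalIntegral.integral_mono_on ht.2 (Continuous.intervalIntegrable (by fun_prop) _ _)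
        (Continuous.intervalIntegrable (by fun_prop) _ _) fun s hs => ?_)
    rw [abs_mul, abs_of_nonneg (by linarith [hs.2])]
    exact mul_le_of_le_one_left (abs_nonneg _) (by linarith [hs.1, ht.1])
  exact (abs_sub _ _).trans (by linarith)

lemma abs_green_sub_le {f : ℝ → ℝ} {p : ℝ} (hp : 1 < p) (hf : Continuous f)
    (hf1 : ∫ s in (0:ℝ)..1, |f s| ^ p ≤ 1) {x y : ℝ} (hx : x ∈ Icc (0:ℝ) 1)
    (hy : y ∈ Icc (0:ℝ) 1) : |green f x - green f y| ≤ 2 * |x - y| :=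
  (convex_Icc (0:ℝ) 1).norm_image_sub_le_of_norm_hasDerivWithin_le
    (fun t _ => (hasDerivAt_green hf t).hasDerivWithinAt)
    (fun _ ht => abs_greenDeriv_le hp hf hf1 ht) hy hx

lemma abs_green_le_two {f : ℝ → ℝ} {p : ℝ} (hp : 1 < p) (hf : Continuous f)
    (hf1 : ∫ s in (0:ℝ)..1, |f s| ^ p ≤ 1) {t : ℝ} (ht : t ∈ Icc (0:ℝ) 1) :
    |green f t| ≤ 2 := by
  have h := abs_green_sub_le hp hf hf1 ht (left_mem_Icc.2 zero_le_one)
  rw [green_zero, sub_zero, sub_zero, abs_of_nonneg ht.1] at h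
  linarith [ht.2]

lemma exists_subseq_tendsto_of_lipschitz {C : ℝ} (hC : 0 ≤ C) (u : ℕ → ℝ → ℝ)
    (hL : ∀ n, ∀ x ∈ Icc (0:ℝ) 1, ∀ y ∈ Icc (0:ℝ) 1, |u n x - u n y| ≤ C * |x - y|)
    (hb : ∀ n, ∀ x ∈ Icc (0:ℝ) 1, |u n x| ≤ C) :
    ∃ v : ℝ → ℝ, Continuous v ∧ ∃ φ : ℕ → ℕ, StrictMono φ ∧
      ∀ x ∈ Icc (0:ℝ) 1, Tendsto (fun n => u (φ n) x) atTop (𝓝 (v x)) := by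
  have hlip : ∀ n, LipschitzWith ⟨C, hC⟩ fun x : Icc (0:ℝ) 1 => u n x := fun n =>
    LipschitzWith.of_dist_le_mul fun x y => hL n x x.2 y y.2
  let F : ℕ → BoundedContinuousFunction (Icc (0:ℝ) 1) ℝ := fun n =>
    BoundedContinuousFunction.mkOfCompact ⟨_, (hlip n).continuous⟩
  have hcomp : IsCompact (closure (range F)) := by
    refine BoundedContinuousFunction.arzela_ascoli (Icc (-C) C) isCompact_Icc (range F) ?_ ?_
    · rintro f x ⟨n, rfl⟩
      exact abs_le.1 (hb n x x.2)
    · refine (LipschitzWith.uniformEquicontinuous _ ⟨C, hC⟩ ?_).equicontinuous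
      rintro ⟨f, n, rfl⟩
      exact hlip n
  obtain ⟨G, -, φ, hφ, hlim⟩ := hcomp.tendsto_subseq fun n => subset_closure (mem_range_self n)
  refine ⟨IccExtend zero_le_one G, G.continuous.Icc_extend', φ, hφ, fun x hx => ?_⟩
  rw [IccExtend_of_mem _ _ hx]
  exact ((continuous_eval_const (⟨x, hx⟩ : Icc (0:ℝ) 1)).tendsto G).comp hlim

lemma tendsto_integral_of_tendsto {C : ℝ} {u : ℕ → ℝ → ℝ} {v : ℝ → ℝ}
    (hu : ∀ n, Continuous (u n)) (hb : ∀ n, ∀ x ∈ Icc (0:ℝ) 1, |u n x| ≤ C)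
    (h : ∀ x ∈ Icc (0:ℝ) 1, Tendsto (fun n => u n x) atTop (𝓝 (v x))) :
    Tendsto (fun n => ∫ t in (0:ℝ)..1, u n t) atTop (𝓝 (∫ t in (0:ℝ)..1, v t)) := by
  have hsub : ∀ x ∈ uIoc (0:ℝ) 1, x ∈ Icc (0:ℝ) 1 := fun x hx => by
    rw [uIoc_of_le zero_le_one] at hx
    exact Ioc_subset_Icc_self hx
  exact intervalIntegral.tendsto_integral_filter_of_dominated_convergence (fun _ => C)
    (.of_forall fun n => (hu n).aestronglyMeasurable)
    (.of_forall fun n => .of_forall fun x hx => hb n x (hsub x hx))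
    (continuous_const.intervalIntegrable _ _) (.of_forall fun x hx => h x (hsub x hx))

lemma eq_of_integral_eq {a b : ℝ → ℝ} (ha : Continuous a) (hb : Continuous b)
    (hab : ∀ t ∈ Icc (0:ℝ) 1, a t ≤ b t)
    (h : ∫ t in (0:ℝ)..1, b t ≤ ∫ t in (0:ℝ)..1, a t) : ∀ t ∈ Icc (0:ℝ) 1, a t = b t := by
  intro t ht
  by_contra hne
  have := intervalIntegral.integral_lt_integral_of_continuousOn_of_le_of_exists_lt one_pos
    ha.continuousOn hb.continuousOn (fun s hs => hab s (Ioc_subset_Icc_self hs))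
    ⟨t, ht, lt_of_le_of_ne (hab t ht) hne⟩
  linarith

lemma continuous_abs_rpow {f : ℝ → ℝ} {r : ℝ} (hf : Continuous f) (hr : 0 < r) :
    Continuous fun t => |f t| ^ r := hf.abs.rpow_const fun _ => .inr hr.le

lemma integral_abs_rpow_pos {f : ℝ → ℝ} {r : ℝ} (hf : Continuous f) (hr : 0 < r) {c : ℝ}
    (hc : c ∈ Icc (0:ℝ) 1) (hfc : f c ≠ 0) : 0 < ∫ t in (0:ℝ)..1, |f t| ^ r :=
  intervalIntegral.integral_pos one_pos (continuous_abs_rpow hf hr).continuousOn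
    (fun _ _ => Real.rpow_nonneg (abs_nonneg _) _)
    ⟨c, hc, Real.rpow_pos_of_pos (abs_pos.2 hfc) _⟩

/-- Integrated Young inequality for functions on the unit interval. -/
lemma integral_mul_rpow_sub_one_le {q : ℝ} (hq : 1 < q) {a b : ℝ → ℝ} (ha : Continuous a)
    (hb : Continuous b) (ha0 : ∀ t ∈ Icc (0:ℝ) 1, 0 ≤ a t) :
    q * ∫ t in (0:ℝ)..1, a t * |b t| ^ (q - 1) ≤
      (∫ t in (0:ℝ)..1, |a t| ^ q) + (q - 1) * ∫ t in (0:ℝ)..1, |b t| ^ q := by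
  have cb' := continuous_abs_rpow hb (sub_pos.2 hq)
  have ca := continuous_abs_rpow ha (zero_lt_one.trans hq)
  have cb := continuous_abs_rpow hb (zero_lt_one.trans hq)
  rw [← intervalIntegral.integral_const_mul, ← intervalIntegral.integral_const_mul,
    ← intervalIntegral.integral_add (ca.intervalIntegrable _ _)
      (Continuous.intervalIntegrable (by fun_prop) _ _)]
  refine intervalIntegral.integral_mono_on zero_le_one
    ((continuous_const.mul (ha.mul cb')).intervalIntegrable _ _)
    ((ca.add (continuous_const.mul cb)).intervalIntegrable _ _) fun t ht => ?_
  rw [abs_of_nonneg (ha0 t ht)]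
  exact mul_rpow_sub_one_le hq (ha0 t ht) (abs_nonneg _)

lemma eq_of_integral_mul_rpow_sub_one {q : ℝ} (hq : 1 < q) {a b : ℝ → ℝ} (ha : Continuous a)
    (hb : Continuous b) (ha0 : ∀ t ∈ Icc (0:ℝ) 1, 0 ≤ a t)
    (h : (∫ t in (0:ℝ)..1, |a t| ^ q) + (q - 1) * ∫ t in (0:ℝ)..1, |b t| ^ q ≤
      q * ∫ t in (0:ℝ)..1, a t * |b t| ^ (q - 1)) : ∀ t ∈ Icc (0:ℝ) 1, a t = |b t| := by
  have cb' := continuous_abs_rpow hb (sub_pos.2 hq)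
  have ca := continuous_abs_rpow ha (zero_lt_one.trans hq)
  have cb := continuous_abs_rpow hb (zero_lt_one.trans hq)
  rw [← intervalIntegral.integral_const_mul, ← intervalIntegral.integral_const_mul,
    ← intervalIntegral.integral_add (ca.intervalIntegrable _ _)
      (Continuous.intervalIntegrable (by fun_prop) _ _)] at h
  intro t ht
  have key := eq_of_integral_eq (a := fun t => q * (a t * |b t| ^ (q - 1)))
    (b := fun t => |a t| ^ q + (q - 1) * |b t| ^ q) (by fun_prop) (by fun_prop) (fun t ht => by
      simp only [abs_of_nonneg (ha0 t ht)]
      exact mul_rpow_sub_one_le hq (ha0 t ht) (abs_nonneg _)) h t ht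
  simp only [abs_of_nonneg (ha0 t ht)] at key
  exact eq_of_mul_rpow_sub_one_eq hq (ha0 t ht) (abs_nonneg _) key

/-- A maximizing sequence for the embedding quotient has a limit point. -/
lemma exists_maximizing_limit {p q : ℝ} (hp : 1 < p) (hq : 1 < q) :
    ∃ M : ℝ, 0 < M ∧
      (∀ f : ℝ → ℝ, Continuous f → (∀ t ∈ Icc (0:ℝ) 1, 0 ≤ f t) →
        ∫ t in (0:ℝ)..1, |f t| ^ p ≤ 1 → ∫ t in (0:ℝ)..1, |green f t| ^ q ≤ M) ∧
      ∃ v : ℝ → ℝ, Continuous v ∧ (∀ t ∈ Icc (0:ℝ) 1, 0 ≤ v t) ∧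
        ∫ t in (0:ℝ)..1, |v t| ^ q = M ∧
        ∀ g : ℝ → ℝ, Continuous g → ∀ B : ℝ,
          (∀ f : ℝ → ℝ, Continuous f → (∀ t ∈ Icc (0:ℝ) 1, 0 ≤ f t) →
            ∫ t in (0:ℝ)..1, |f t| ^ p ≤ 1 → ∫ t in (0:ℝ)..1, green f t * g t ≤ B) →
          ∫ t in (0:ℝ)..1, v t * g t ≤ B := by
  have hq0 : 0 < q := zero_lt_one.trans hq
  let S : Set ℝ := {m | ∃ f : ℝ → ℝ, Continuous f ∧ (∀ t ∈ Icc (0:ℝ) 1, 0 ≤ f t) ∧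
    ∫ t in (0:ℝ)..1, |f t| ^ p ≤ 1 ∧ ∫ t in (0:ℝ)..1, |green f t| ^ q = m}
  have hbdd : BddAbove S := by
    refine ⟨2 ^ q, ?_⟩
    rintro m ⟨f, hf, -, hf1, rfl⟩
    calc ∫ t in (0:ℝ)..1, |green f t| ^ q ≤ ∫ t in (0:ℝ)..1, (2:ℝ) ^ q :=
          intervalIntegral.integral_mono_on zero_le_one
            ((continuous_abs_rpow (continuous_green hf) hq0).intervalIntegrable _ _)
            (continuous_const.intervalIntegrable _ _) fun t ht =>
            Real.rpow_le_rpow (abs_nonneg _) (abs_green_le_two hp hf hf1 ht) hq0.le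
      _ = 2 ^ q := by simp
  have hone : ∫ t in (0:ℝ)..1, |green (fun _ => 1) t| ^ q ∈ S :=
    ⟨fun _ => 1, continuous_const, fun _ _ => zero_le_one, by simp, rfl⟩
  have hhalf : (1 / 2 : ℝ) ∈ Ioo (0:ℝ) 1 := by constructor <;> norm_num
  have hpos : 0 < ∫ t in (0:ℝ)..1, |green (fun _ => 1) t| ^ q :=
    integral_abs_rpow_pos (continuous_green continuous_const) hq0 (Ioo_subset_Icc_self hhalf)
      (green_pos continuous_const (fun _ _ => zero_le_one) ⟨1 / 2, hhalf, one_pos⟩ hhalf).ne'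
  obtain ⟨m, -, hm, hmS⟩ := exists_seq_tendsto_sSup ⟨_, hone⟩ hbdd
  choose f hf hf0 hf1 hfm using hmS
  obtain ⟨v, hv, φ, hφ, hlim⟩ := exists_subseq_tendsto_of_lipschitz zero_le_two
    (fun n => green (f n)) (fun n x hx y hy => abs_green_sub_le hp (hf n) (hf1 n) hx hy)
    (fun n x hx => abs_green_le_two hp (hf n) (hf1 n) hx)
  refine ⟨sSup S, hpos.trans_le (le_csSup hbdd hone),
    fun f hf hf0 hf1 => le_csSup hbdd ⟨f, hf, hf0, hf1, rfl⟩, v, hv, fun t ht =>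
      ge_of_tendsto' (hlim t ht) fun n => green_nonneg (hf _) (hf0 _) ht, ?_, fun g hg B hB => ?_⟩
  · have h1 := tendsto_integral_of_tendsto (C := 2 ^ q)
      (u := fun n t => |green (f (φ n)) t| ^ q) (v := fun t => |v t| ^ q)
      (fun n => continuous_abs_rpow (continuous_green (hf _)) hq0)
      (fun n x hx => by
        rw [abs_of_nonneg (Real.rpow_nonneg (abs_nonneg _) _)]
        exact Real.rpow_le_rpow (abs_nonneg _) (abs_green_le_two hp (hf _) (hf1 _) hx) hq0.le)
      (fun x hx => (hlim x hx).abs.rpow_const (.inr hq0.le))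
    simp only [hfm] at h1
    exact tendsto_nhds_unique h1 (hm.comp hφ.tendsto_atTop)
  · obtain ⟨C, hC⟩ := isCompact_Icc.exists_bound_of_continuousOn (hg.continuousOn (s := Icc 0 1))
    have h1 := tendsto_integral_of_tendsto (C := 2 * C)
      (u := fun n t => green (f (φ n)) t * g t) (v := fun t => v t * g t)
      (fun n => (continuous_green (hf _)).mul hg)
      (fun n x hx => by
        rw [abs_mul]
        exact mul_le_mul (abs_green_le_two hp (hf _) (hf1 _) hx) (hC x hx) (abs_nonneg _)
          zero_le_two)
      (fun x hx => (hlim x hx).mul_const _)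
    exact le_of_tendsto' h1 fun n => hB _ (hf _) (hf0 _) (hf1 _)

/-- The best constant is attained at a positive Navier eigenfunction. -/
lemma exists_extremal_navierSol {p q : ℝ} (hp : 1 < p) (hq : 1 < q) :
    ∃ M : ℝ, 0 < M ∧
      (∀ f : ℝ → ℝ, Continuous f → (∀ t ∈ Icc (0:ℝ) 1, 0 ≤ f t) →
        ∫ t in (0:ℝ)..1, |f t| ^ p ≤ 1 → ∫ t in (0:ℝ)..1, |green f t| ^ q ≤ M) ∧
      ∃ u : ℝ → ℝ, NavierSol p q M⁻¹ 1 u ∧ ∫ t in (0:ℝ)..1, |deriv (deriv u) t| ^ p = 1 ∧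
        ∀ t ∈ Ioo (0:ℝ) 1, 0 < u t := by
  obtain ⟨M, hM, hmax, v, hv, hv0, hvM, hlim⟩ := exists_maximizing_limit hp hq
  have hp0 : 0 < p := zero_lt_one.trans hp
  have hp1 : 0 < p - 1 := sub_pos.2 hp
  have hq1 : 0 < q - 1 := sub_pos.2 hq
  have hhalf : (1 / 2 : ℝ) ∈ Ioo (0:ℝ) 1 := by constructor <;> norm_num
  set g : ℝ → ℝ := fun t => |v t| ^ (q - 1) with hg_def
  have hg : Continuous g := continuous_abs_rpow hv hq1
  have hg0 : ∀ t, 0 ≤ g t := fun t => Real.rpow_nonneg (abs_nonneg _) _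
  have hgpos : ∃ c ∈ Ioo (0:ℝ) 1, 0 < g c := by
    by_contra! hcon
    have hz : ∀ t ∈ Ioo (0:ℝ) 1, |v t| ^ q = 0 := fun t ht => by
      have := le_antisymm (hcon t ht) (hg0 t)
      rw [(Real.rpow_eq_zero (abs_nonneg _) hq1.ne').1 this, Real.zero_rpow (by linarith)]
    rw [intervalIntegral.integral_congr_Ioo_of_le zero_le_one hz] at hvM
    simp at hvM
    exact hM.ne hvM
  have hw : Continuous (green g) := continuous_green hg
  have hw0 : ∀ t ∈ Icc (0:ℝ) 1, 0 ≤ green g t := fun t ht =>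
    green_nonneg hg (fun t _ => hg0 t) ht
  have hwpos : ∀ t ∈ Ioo (0:ℝ) 1, 0 < green g t := fun t ht =>
    green_pos hg (fun t _ => hg0 t) hgpos ht
  have hs : 0 < (p - 1)⁻¹ := inv_pos.2 hp1
  set h : ℝ → ℝ := fun t => spow (p - 1)⁻¹ (green g t) with hh_def
  have hh : Continuous h := (continuous_spow hs).comp hw
  have hh0 : ∀ t ∈ Icc (0:ℝ) 1, 0 ≤ h t := fun t ht => by
    rw [hh_def]
    simp only
    rw [spow_of_nonneg hs (hw0 t ht)]
    exact Real.rpow_nonneg (hw0 t ht) _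
  have hhpos : ∀ t ∈ Ioo (0:ℝ) 1, 0 < h t := fun t ht => by
    rw [hh_def]
    simp only
    rw [spow_of_nonneg hs (hwpos t ht).le]
    exact Real.rpow_pos_of_pos (hwpos t ht) _
  set D : ℝ := ∫ t in (0:ℝ)..1, |h t| ^ p with hD_def
  have hD : 0 < D :=
    integral_abs_rpow_pos hh hp0 (Ioo_subset_Icc_self hhalf) (hhpos _ hhalf).ne'
  set c : ℝ := D ^ (-p⁻¹) with hc_def
  have hc : 0 < c := Real.rpow_pos_of_pos hD _
  have hcD : c ^ p * D = 1 := by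
    rw [hc_def, ← Real.rpow_mul hD.le, neg_mul, inv_mul_cancel₀ hp0.ne', Real.rpow_neg_one,
      inv_mul_cancel₀ hD.ne']
  set f : ℝ → ℝ := fun t => c * h t with hf_def
  have hf : Continuous f := continuous_const.mul hh
  have hf0 : ∀ t ∈ Icc (0:ℝ) 1, 0 ≤ f t := fun t ht => mul_nonneg hc.le (hh0 t ht)
  have hf1 : ∫ t in (0:ℝ)..1, |f t| ^ p = 1 := by
    simp only [hf_def, abs_mul, abs_of_pos hc, Real.mul_rpow hc.le (abs_nonneg _),
      intervalIntegral.integral_const_mul]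
    exact hcD
  set κ : ℝ := c ^ (p - 1) with hκ_def
  have hκ : 0 < κ := Real.rpow_pos_of_pos hc _
  have hfw : ∀ t, spow (p - 1) (f t) = κ * green g t := fun t =>
    spow_mul_spow hp1 hs (inv_mul_cancel₀ hp1.ne') hc.le _
  have hfw' : ∀ t ∈ Icc (0:ℝ) 1, |f t| ^ (p - 1) = κ * green g t := fun t ht => by
    rw [← hfw, spow_of_nonneg hp1 (hf0 t ht), abs_of_nonneg (hf0 t ht)]
  have hpair : ∀ f' : ℝ → ℝ, Continuous f' →
      ∫ t in (0:ℝ)..1, f' t * |f t| ^ (p - 1) = κ * ∫ t in (0:ℝ)..1, green f' t * g t := by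
    intro f' hf'
    rw [integral_green_mul hf' hg, ← intervalIntegral.integral_const_mul]
    refine intervalIntegral.integral_congr fun t ht => ?_
    rw [uIcc_of_le zero_le_one] at ht
    simp only [hfw' t ht]
    ring
  have hvg : ∫ t in (0:ℝ)..1, v t * g t = M := by
    rw [← hvM]
    refine intervalIntegral.integral_congr fun t ht => ?_
    rw [uIcc_of_le zero_le_one] at ht
    simp only [hg_def]
    rw [← mul_spow_sub_one hq, spow_of_nonneg hq1 (hv0 t ht), abs_of_nonneg (hv0 t ht)]
  have hle : M ≤ κ⁻¹ := by
    rw [← hvg]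
    refine hlim g hg _ fun f' hf' hf'0 hf'1 => ?_
    have := integral_mul_rpow_sub_one_le hp hf' hf hf'0
    rw [hpair f' hf', hf1] at this
    rw [← one_div, le_div_iff₀' hκ]
    nlinarith
  have hfg : ∫ t in (0:ℝ)..1, green f t * g t = κ⁻¹ := by
    have e : ∫ t in (0:ℝ)..1, f t * |f t| ^ (p - 1) = 1 := by
      refine Eq.trans ?_ hf1
      refine intervalIntegral.integral_congr fun t ht => ?_
      rw [uIcc_of_le zero_le_one] at ht
      rw [← mul_spow_sub_one hp, spow_of_nonneg hp1 (hf0 t ht), abs_of_nonneg (hf0 t ht)]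
    rw [hpair f hf] at e
    exact eq_inv_of_mul_eq_one_right e
  have hgf := hmax f hf hf0 hf1.le
  have hgf0 : ∀ t ∈ Icc (0:ℝ) 1, 0 ≤ green f t := fun t ht => green_nonneg hf hf0 ht
  have hyoung := integral_mul_rpow_sub_one_le hq (continuous_green hf) hv hgf0
  rw [hvM] at hyoung
  have hκM : κ⁻¹ = M := by
    refine le_antisymm ?_ hle
    rw [← hfg]
    nlinarith
  have heq : ∀ t ∈ Icc (0:ℝ) 1, green f t = |v t| := by
    refine eq_of_integral_mul_rpow_sub_one hq (continuous_green hf) hv hgf0 ?_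
    have : ∫ t in (0:ℝ)..1, green f t * |v t| ^ (q - 1) = M := hfg.trans hκM
    rw [this, hvM]
    linarith
  have hfun : (fun t => spow (p - 1) (deriv (deriv (green f)) t)) =
      green fun s => -κ * g s := by
    funext t
    rw [deriv_deriv_green hf, spow_neg, hfw, green_const_mul, neg_mul]
  have hκg : Continuous fun s => -κ * g s := continuous_const.mul hg
  have hf_zero : ∀ t, green g t = 0 → f t = 0 := fun t ht => by
    simp only [hf_def, hh_def, ht, spow_zero, mul_zero]
  refine ⟨M, hM, hmax, green f, ⟨contDiff_green hf, hfun ▸ contDiff_green hκg, fun t ht => ?_,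
    green_zero f, green_one f, ?_, ?_⟩, ?_, fun t ht => ?_⟩
  · rw [hfun, deriv_deriv_green hκg, spow_of_nonneg hq1 (hgf0 t ht), heq t ht, ← hκM, inv_inv]
    simp [hg_def]
  · rw [deriv_deriv_green hf, hf_zero 0 (green_zero g), neg_zero]
  · rw [deriv_deriv_green hf, hf_zero 1 (green_one g), neg_zero]
  · simpa only [deriv_deriv_green hf, abs_neg] using hf1
  · exact green_pos hf hf0 ⟨1 / 2, hhalf, mul_pos hc (hhpos _ hhalf)⟩ ht

/-- Homogeneous form of the embedding inequality on the unit interval. -/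
lemma integral_abs_rpow_le {p q M : ℝ} (hp : 1 < p) (hq : 1 < q)
    (hmax : ∀ f : ℝ → ℝ, Continuous f → (∀ t ∈ Icc (0:ℝ) 1, 0 ≤ f t) →
        ∫ t in (0:ℝ)..1, |f t| ^ p ≤ 1 → ∫ t in (0:ℝ)..1, |green f t| ^ q ≤ M)
    {u : ℝ → ℝ} (hu : ContDiff ℝ 2 u) (u0 : u 0 = 0) (u1 : u 1 = 0)
    (hN : 0 < ∫ t in (0:ℝ)..1, |deriv (deriv u) t| ^ p) :
    (∫ t in (0:ℝ)..1, |u t| ^ q) ^ (1 / q) ≤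
      M ^ (1 / q) * (∫ t in (0:ℝ)..1, |deriv (deriv u) t| ^ p) ^ (1 / p) := by
  have hp0 : 0 < p := zero_lt_one.trans hp
  have hq0 : 0 < q := zero_lt_one.trans hq
  set N := ∫ t in (0:ℝ)..1, |deriv (deriv u) t| ^ p with hN_def
  set a := N ^ (1 / p) with ha_def
  have ha : 0 < a := Real.rpow_pos_of_pos hN _
  have hap : a ^ p = N := by
    rw [ha_def, ← Real.rpow_mul hN.le, one_div_mul_cancel hp0.ne', Real.rpow_one]
  have hu2 : Continuous (deriv (deriv u)) := hu.hasDerivAt_two.2.2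
  have hf : Continuous fun s => a⁻¹ * |deriv (deriv u) s| := continuous_const.mul hu2.abs
  have hM := hmax _ hf (fun t _ => mul_nonneg (inv_pos.2 ha).le (abs_nonneg _)) (by
    simp only [abs_mul, abs_abs, abs_of_pos (inv_pos.2 ha),
      Real.mul_rpow (inv_pos.2 ha).le (abs_nonneg _), intervalIntegral.integral_const_mul]
    rw [← hN_def, Real.inv_rpow ha.le, hap, inv_mul_cancel₀ hN.ne'])
  have hle : ∀ t ∈ Icc (0:ℝ) 1,
      |u t| ≤ a * |green (fun s => a⁻¹ * |deriv (deriv u) s|) t| := fun t ht => by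
    rw [green_const_mul, abs_mul, abs_of_pos (inv_pos.2 ha), mul_inv_cancel_left₀ ha.ne',
      ← green_neg_deriv_deriv hu u0 u1 t]
    refine (abs_green_le hu2.neg ht).trans (le_trans ?_ (le_abs_self _))
    simp
  have hint : ∫ t in (0:ℝ)..1, |u t| ^ q ≤ a ^ q * M := by
    calc ∫ t in (0:ℝ)..1, |u t| ^ q
        ≤ ∫ t in (0:ℝ)..1, a ^ q * |green (fun s => a⁻¹ * |deriv (deriv u) s|) t| ^ q := by
          refine intervalIntegral.integral_mono_on zero_le_one
            ((continuous_abs_rpow hu.continuous hq0).intervalIntegrable _ _)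
            ((continuous_const.mul
              (continuous_abs_rpow (continuous_green hf) hq0)).intervalIntegrable _ _)
            fun t ht => ?_
          rw [← Real.mul_rpow ha.le (abs_nonneg _)]
          exact Real.rpow_le_rpow (abs_nonneg _) (hle t ht) hq0.le
      _ ≤ a ^ q * M := by
          rw [intervalIntegral.integral_const_mul]
          exact mul_le_mul_of_nonneg_left hM (Real.rpow_nonneg ha.le _)
  have hM0 : 0 ≤ M := (intervalIntegral.integral_nonneg zero_le_one
    fun t _ => Real.rpow_nonneg (abs_nonneg _) _).trans hM
  refine (Real.rpow_le_rpow (intervalIntegral.integral_nonneg zero_le_one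
    fun t _ => Real.rpow_nonneg (abs_nonneg _) _) hint (by positivity)).trans_eq ?_
  rw [Real.mul_rpow (Real.rpow_nonneg ha.le _) hM0, ← Real.rpow_mul ha.le,
    mul_one_div_cancel hq0.ne', Real.rpow_one, mul_comm]

lemma deriv_deriv_comp_mul_left (c : ℝ) (u : ℝ → ℝ) (t : ℝ) :
    deriv (deriv fun s => u (c * s)) t = c ^ 2 * deriv (deriv u) (c * t) := by
  have h : deriv (fun s => u (c * s)) = fun s => c * deriv u (c * s) :=
    funext fun s => by simpa using deriv_comp_mul_left c u s
  rw [h, deriv_const_mul_field, deriv_comp_mul_left c (deriv u) t, smul_eq_mul]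
  ring

/-- Rescaling of the embedding quotient from `[0, c]` to `[0, 1]`. -/
lemma quotient_rescale {p q c : ℝ} (hp : 1 < p) (hc : 0 < c) (u : ℝ → ℝ) :
    (∫ t in (0:ℝ)..c, |u t| ^ q) ^ (1 / q) /
        (∫ t in (0:ℝ)..c, |deriv (deriv u) t| ^ p) ^ (1 / p) =
      c ^ (1 / q - 1 / p + 2) *
        ((∫ t in (0:ℝ)..1, |u (c * t)| ^ q) ^ (1 / q) /
          (∫ t in (0:ℝ)..1, |deriv (deriv fun s => u (c * s)) t| ^ p) ^ (1 / p)) := by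
  have hp0 : 0 < p := zero_lt_one.trans hp
  have nn : ∀ (r : ℝ) (w : ℝ → ℝ), 0 ≤ ∫ t in (0:ℝ)..1, |w t| ^ r := fun r w =>
    intervalIntegral.integral_nonneg zero_le_one fun t _ => Real.rpow_nonneg (abs_nonneg _) _
  have hsub : ∀ F : ℝ → ℝ, ∫ t in (0:ℝ)..c, F t = c * ∫ t in (0:ℝ)..1, F (c * t) := fun F => by
    rw [intervalIntegral.integral_comp_mul_left F hc.ne', smul_eq_mul, mul_inv_cancel_left₀ hc.ne',
      mul_zero, mul_one]
  simp only [hsub fun t => |u t| ^ q, hsub fun t => |deriv (deriv u) t| ^ p,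
    deriv_deriv_comp_mul_left, abs_mul, abs_of_pos (pow_pos hc 2),
    Real.mul_rpow (pow_pos hc 2).le (abs_nonneg _),
    intervalIntegral.integral_const_mul]
  rw [Real.mul_rpow hc.le (nn q fun t => u (c * t)),
    Real.mul_rpow hc.le (nn p fun t => deriv (deriv u) (c * t)),
    Real.mul_rpow (by positivity) (nn p fun t => deriv (deriv u) (c * t)),
    ← Real.rpow_mul (by positivity), mul_one_div_cancel hp0.ne', Real.rpow_one,
    Real.rpow_add hc, Real.rpow_sub hc, Real.rpow_two]
  field_simp

lemma integral_abs_rpow_of_navierSol {p q lam : ℝ} (hp : 1 < p) (hq : 1 < q) {u : ℝ → ℝ}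
    (hu : NavierSol p q lam 1 u) :
    lam * ∫ t in (0:ℝ)..1, |u t| ^ q = ∫ t in (0:ℝ)..1, |deriv (deriv u) t| ^ p := by
  obtain ⟨h1, h2, h3, u0, u1, v0, v1⟩ := hu
  have key := integral_mul_second_deriv h1.hasDerivAt_two.1 h1.hasDerivAt_two.2.1
    h1.hasDerivAt_two.2.2 h2.hasDerivAt_two.1 h2.hasDerivAt_two.2.1 h2.hasDerivAt_two.2.2
    u0 u1 (by rw [v0, spow_zero]) (by rw [v1, spow_zero])
  simp only [mul_spow_sub_one hp] at key
  rw [← key, ← intervalIntegral.integral_const_mul]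
  refine intervalIntegral.integral_congr fun t ht => ?_
  rw [uIcc_of_le zero_le_one] at ht
  rw [h3 t ht, mul_left_comm, mul_spow_sub_one hq]

/-- the norm of the second-order embedding
E₂ : W^{2,p}_D(0,t₀) → L^q(0,t₀) equals t₀^{1/q-1/p+2}·λ₁^{-1/q}, where λ₁ is the
smallest λ > 0 for which the Navier problem on [0,1], normalized by ‖u''‖_p = 1,
has a solution positive on (0,1). -/
theorem stmt18 (p q t₀ lam1 : ℝ) (hp : 1 < p) (hq : 1 < q) (ht₀ : 0 < t₀)
    (hlam1 : IsLeast {lam : ℝ | 0 < lam ∧ ∃ u : ℝ → ℝ, NavierSol p q lam 1 u ∧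
        (∫ t in (0:ℝ)..1, |deriv (deriv u) t| ^ p) ^ (1 / p) = 1 ∧
        ∀ t ∈ Set.Ioo (0:ℝ) 1, 0 < u t} lam1) :
    IsLUB {x : ℝ | ∃ u : ℝ → ℝ, ContDiff ℝ 2 u ∧ u 0 = 0 ∧ u t₀ = 0 ∧
        (∃ t ∈ Set.Icc (0:ℝ) t₀, u t ≠ 0) ∧
        x = (∫ t in (0:ℝ)..t₀, |u t| ^ q) ^ (1 / q) /
              (∫ t in (0:ℝ)..t₀, |deriv (deriv u) t| ^ p) ^ (1 / p)}
      (t₀ ^ (1 / q - 1 / p + 2) * lam1 ^ (-(1 / q))) := by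
  obtain ⟨⟨hlam, u, hu, hnorm, hupos⟩, hleast⟩ := hlam1
  have hp0 : 0 < p := zero_lt_one.trans hp
  have hq0 : 0 < q := zero_lt_one.trans hq
  have hscale : 0 ≤ t₀ ^ (1 / q - 1 / p + 2) := Real.rpow_nonneg ht₀.le _
  refine IsGreatest.isLUB ⟨?_, ?_⟩
  · have hcancel : ∀ t, t₀⁻¹ * (t₀ * t) = t := fun t => inv_mul_cancel_left₀ ht₀.ne' t
    refine ⟨fun t => u (t₀⁻¹ * t), hu.1.comp (contDiff_const.mul contDiff_id), ?_, ?_,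
      ⟨t₀ * (1 / 2), ⟨by positivity, by linarith⟩, ?_⟩, ?_⟩
    · simpa using hu.2.2.2.1
    · simpa [inv_mul_cancel₀ ht₀.ne'] using hu.2.2.2.2.1
    · simp only [hcancel]
      exact (hupos _ (by constructor <;> norm_num)).ne'
    · rw [quotient_rescale hp ht₀]
      simp only [hcancel]
      rw [hnorm, div_one]
      have hN : ∫ t in (0:ℝ)..1, |deriv (deriv u) t| ^ p = 1 := by
        have h0 : 0 ≤ ∫ t in (0:ℝ)..1, |deriv (deriv u) t| ^ p :=
          intervalIntegral.integral_nonneg zero_le_one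
            fun t _ => Real.rpow_nonneg (abs_nonneg _) _
        exact (Real.rpow_left_inj h0 zero_le_one (one_div_pos.2 hp0).ne').1
          (hnorm.trans (Real.one_rpow _).symm)
      have hI := integral_abs_rpow_of_navierSol hp hq hu
      rw [hN] at hI
      rw [eq_inv_of_mul_eq_one_right hI, Real.inv_rpow hlam.le, Real.rpow_neg hlam.le]
  · rintro x ⟨w, hw, w0, w1, -, rfl⟩
    rw [quotient_rescale hp ht₀]
    refine mul_le_mul_of_nonneg_left ?_ hscale
    obtain ⟨M, hM, hmax, z, hz, hz1, hzpos⟩ := exists_extremal_navierSol hp hq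
    have hlamM : lam1 ≤ M⁻¹ :=
      hleast ⟨inv_pos.2 hM, z, hz, by rw [hz1, Real.one_rpow], hzpos⟩
    have hMlam : M ^ (1 / q) ≤ lam1 ^ (-(1 / q)) := by
      rw [Real.rpow_neg hlam.le, ← Real.inv_rpow hlam.le]
      exact Real.rpow_le_rpow hM.le ((le_inv_comm₀ hlam hM).1 hlamM) (by positivity)
    have hcd : ContDiff ℝ 2 fun s => w (t₀ * s) := hw.comp (contDiff_const.mul contDiff_id)
    have h0 : 0 ≤ ∫ t in (0:ℝ)..1, |deriv (deriv fun s => w (t₀ * s)) t| ^ p :=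
      intervalIntegral.integral_nonneg zero_le_one fun t _ => Real.rpow_nonneg (abs_nonneg _) _
    rcases h0.eq_or_lt with h | h
    · rw [← h, Real.zero_rpow (by positivity), div_zero]
      exact Real.rpow_nonneg hlam.le _
    · rw [div_le_iff₀ (Real.rpow_pos_of_pos h _)]
      exact (integral_abs_rpow_le hp hq hmax hcd (by simpa using w0) (by simpa using w1) h).trans
        (mul_le_mul_of_nonneg_right hMlam (Real.rpow_nonneg h0 _))
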